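/- Let κ be a kernel on S that is irreducible with respect to a probability vector μ on S with μ_r > 0 for all r. For t ∈ [0,∞) and k ∈ ℕ₀^S with k ≠ 0 define λ_k(t) = t^{|k|−1} · τ(k;κ) · e^{−t⟨k,κμ⟩} · ∏_{r∈S} μ_r^{k_r}/k_r!, where ⟨k,κμ⟩ = ∑_{r,s∈S} k_r κ(r,s) μ_s and 0^0 = 1 (so λ_{e_r}(0) = μ_r and λ_k(0) = 0 when |k| ≥ 2). Then for every k ∈ ℕ₀^S with k ≠ 0 and every t ∈ (0,∞), the function λ_k is differentiable at t with derivative d/dt λ_k(t) = (1/2) ∑_{m,m̃ ∈ ℕ₀^S∖{0} : m + m̃ = k} λ_m(t) λ_{m̃}(t) ⟨m, κ m̃⟩ − λ_k(t) ⟨k, κμ⟩, where ⟨m, κ m̃⟩ = ∑_{r,s∈S} m_r κ(r,s) m̃_s; that is, t ↦ (λ_k(t))_k solves the multi-type Flory coagulation equation with monodisperse initial condition λ_k(0) = ∑_{r∈S} μ_r 1_{k = e_r}. -/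

import Mathlib

open scoped Classical ENNReal
open Filter MeasureTheory

noncomputable section

/-- The set of ordered pairs `(i,j)` of vertices with `i < j`, representing the
potential edges of a graph on `Fin n`. -/
def upperPairs (n : ℕ) : Finset (Fin n × Fin n) :=
  Finset.univ.filter fun q => q.1 < q.2

/-- The simple graph on `Fin n` determined by a finite set of (ordered) edges. -/
def graphOf {n : ℕ} (E : Finset (Fin n × Fin n)) : SimpleGraph (Fin n) :=
  SimpleGraph.fromRel fun i j => (i, j) ∈ E

/-- `PConn n x p` is the probability that the inhomogeneous random graph `G(n, x, p)`,
with type vector `x` and independent edges where `{i,j}` is present with probability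
`p (x i) (x j)`, is connected; written as a finite sum over connected graphs. -/
def PConn {S : Type*} (n : ℕ) (x : Fin n → S) (p : S → S → ℝ) : ℝ :=
  ∑ E ∈ (upperPairs n).powerset.filter (fun E => (graphOf E).Connected),
    (∏ q ∈ E, p (x q.1) (x q.2)) * ∏ q ∈ upperPairs n \ E, (1 - p (x q.1) (x q.2))

/-- Sum over all spanning trees (connected graphs with `n - 1` edges) on `Fin n` of the
product of the kernel over the edges. -/
def treeWeight {S : Type*} (n : ℕ) (x : Fin n → S) (κ : S → S → ℝ) : ℝ :=
  ∑ E ∈ (upperPairs n).powerset.filter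
      (fun E => (graphOf E).Connected ∧ E.card + 1 = n),
    ∏ q ∈ E, κ (x q.1) (x q.2)

/-- A canonical list of types compatible with the multiplicity vector `k`. -/
def compatList {S : Type*} [Fintype S] (k : S → ℕ) : List S :=
  (∑ s : S, (k s) • ({s} : Multiset S)).toList

lemma compatList_length {S : Type*} [Fintype S] (k : S → ℕ) :
    (compatList k).length = ∑ s : S, k s := by
  simp [compatList]

/-- A canonical type vector compatible with `k`, i.e. with `∑ i δ_{x i} = k`. -/
def compatVec {S : Type*} [Fintype S] (k : S → ℕ) : Fin (∑ s : S, k s) → S :=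
  fun i => (compatList k).get (Fin.cast (compatList_length k).symm i)

/-- `tau κ k` is the spanning-tree weight `τ(k; κ)`. -/
def tau {S : Type*} [Fintype S] (κ : S → S → ℝ) (k : S → ℕ) : ℝ :=
  treeWeight (∑ s : S, k s) (compatVec k) κ

/-- `pN κN N k` is the probability that the inhomogeneous random graph on a vertex set
with type composition `k` and edge probabilities `min 1 (κN/N)` is connected. -/
def pN {S : Type*} [Fintype S] (κN : S → S → ℝ) (N : ℕ) (k : S → ℕ) : ℝ :=
  PConn (∑ s : S, k s) (compatVec k) fun r s => min 1 (κN r s / N)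

/-- Extended-real logarithm, with `elog x = -∞` for `x ≤ 0`. -/
def elog (x : ℝ) : EReal := if x ≤ 0 then (⊥ : EReal) else ((Real.log x : ℝ) : EReal)

/-- The nonnegative part of `-log u`, equal to `∞` if `u ≤ 0`. -/
def negLogPart (u : ℝ) : ℝ≥0∞ := if u ≤ 0 then ⊤ else ENNReal.ofReal (-Real.log u)

/-- The relative-entropy summand `x log (x / d)` with conventions `0 log 0 = 0` and
`x log (x/0) = +∞` for `x ≠ 0`. -/
def entTerm (x d : ℝ) : EReal :=
  if x = 0 then (0 : EReal) else if d ≤ 0 then (⊤ : EReal)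
  else ((x * Real.log (x / d) : ℝ) : EReal)

/-- `‖κ‖_∞ = max_{r,s} κ r s`. -/
def kernelSup {S : Type*} [Fintype S] [Nonempty S] (κ : S → S → ℝ) : ℝ :=
  Finset.univ.sup' Finset.univ_nonempty fun r =>
    Finset.univ.sup' Finset.univ_nonempty fun s => κ r s

/-- `Σ(κ, ν)`, the `ℓ²(ν)`-operator norm of the matrix `(κ r s * ν s)_{r,s}`. -/
def sigmaOp {S : Type*} [Fintype S] (κ : S → S → ℝ) (ν : S → ℝ) : ℝ :=
  sSup { t : ℝ | ∃ f : S → ℝ, (∀ s, 0 ≤ f s) ∧ (∑ r : S, ν r * f r ^ 2) ≤ 1 ∧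
    t = Real.sqrt (∑ r : S, ν r * (∑ s : S, κ r s * f s * ν s) ^ 2) }

/-- Irreducibility of the kernel `κ` with respect to `ν`. -/
def Irred {S : Type*} (κ : S → S → ℝ) (ν : S → ℝ) : Prop :=
  ∀ A : Set S, (∀ r ∈ A, ∀ s, s ∉ A → 0 < ν r → 0 < ν s → κ r s = 0) →
    (∀ r ∈ A, ν r = 0) ∨ (∀ s, s ∉ A → ν s = 0)

/-- The generating series `Γ_r(θ) = ∑_k τ(k) k_r ∏_s θ_s^{k_s}/k_s! ∈ [0,∞]`. -/
def Gamma0 {S : Type*} [Fintype S] (κ : S → S → ℝ) (θ : S → ℝ) (r : S) : ℝ≥0∞ :=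
  ∑' k : S → ℕ,
    ENNReal.ofReal (tau κ k * (k r : ℝ) * ∏ s : S, θ s ^ (k s) / (Nat.factorial (k s) : ℝ))

/-- `χ(κ, θ)`: the infimum over probability vectors `w ≪ θ` of
`∑_r w_r log (w_r / ((κ w)_r θ_r))`. -/
def chiFn {S : Type*} [Fintype S] (κ : S → S → ℝ) (θ : S → ℝ) : EReal :=
  sInf { v : EReal | ∃ w : S → ℝ, (∀ r, 0 ≤ w r) ∧ ((∑ r : S, w r) = 1) ∧
    (∀ r, θ r = 0 → w r = 0) ∧
    v = ∑ r : S, entTerm (w r) ((∑ s : S, κ r s * w s) * θ r) }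

/-- `Δ_r(k)`: the sum over directed spanning trees of the support of `k` rooted at `r`
(encoded as parent maps `f`, edges `(f s, s)` directed away from the root) of
`∏ κ(f s, s) * k (f s)`. -/
def Delta {S : Type*} [Fintype S] [DecidableEq S] (κ : S → S → ℝ) (k : S → ℕ) (r : S) : ℝ :=
  ∑ f ∈ (Finset.univ : Finset (S → S)).filter (fun f =>
      (∀ s, (s = r ∨ k s = 0) → f s = s) ∧
      ∀ s, 0 < k s → s ≠ r → (0 < k (f s) ∧ ∃ n, f^[n] s = r)),
    ∏ s ∈ Finset.univ.filter (fun s => 0 < k s ∧ s ≠ r), (κ (f s) s * (k (f s) : ℝ))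

/-- The reference weight `τ(k) ∏_s μ_s^{k_s}/k_s!`. -/
def rhoMu {S : Type*} [Fintype S] (κ : S → S → ℝ) (μ : S → ℝ) (k : S → ℕ) : ℝ :=
  tau κ k * ∏ s : S, μ s ^ (k s) / (Nat.factorial (k s) : ℝ)

/-- The microscopic rate function `I_Mi`. -/
def IMi {S : Type*} [Fintype S] (κ : S → S → ℝ) (μ : S → ℝ) (lam : (S → ℕ) → ℝ) : EReal :=
  (∑' k : S → ℕ, entTerm (lam k) (rhoMu κ μ k))
  + ((∑' k : S → ℕ, lam k * (((∑ s : S, k s : ℕ) : ℝ) - 1) : ℝ) : EReal)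
  + ((((1 : ℝ)/2) * ∑ r : S, ∑ s : S, (∑' k : S → ℕ, lam k * (k r : ℝ)) * κ r s * μ s : ℝ) : EReal)

/-- The minimizer candidate `λ_k(c) = τ(k) ∏_s (c_s e^{-(κ c)_s})^{k_s}/k_s!`. -/
def lamC {S : Type*} [Fintype S] (κ : S → S → ℝ) (c : S → ℝ) (k : S → ℕ) : ℝ :=
  tau κ k * ∏ s : S, (c s * Real.exp (-(∑ t : S, κ s t * c t))) ^ (k s) / (Nat.factorial (k s) : ℝ)

/-- The mesoscopic rate function `I_Me`. -/
def IMe {S : Type*} [Fintype S] (κ : S → S → ℝ) (μ ν : S → ℝ) : EReal :=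
  (∑ r : S, entTerm (ν r) ((∑ s : S, κ r s * ν s) * μ r))
  + ((((1 : ℝ)/2) * ∑ r : S, ∑ s : S, ν r * κ r s * μ s : ℝ) : EReal)

/-- `b` is a solution of the fixed-point system for `c`:
`b ∈ [0,∞)^S`, `b ≤ c` and `(κ(c-b))_r b_r = c_r - b_r` for all `r`. -/
def IsFPSol {S : Type*} [Fintype S] (κ : S → S → ℝ) (c b : S → ℝ) : Prop :=
  (∀ r, 0 ≤ b r) ∧ (∀ r, b r ≤ c r) ∧
    ∀ r, (∑ s : S, κ r s * (c s - b s)) * b r = c r - b r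

/-- The macroscopic rate summand `f_Ma`. -/
def fMa {S : Type*} [Fintype S] (κ : S → S → ℝ) (μ y : S → ℝ) : EReal :=
  (∑ r : S, entTerm (y r) ((1 - Real.exp (-(∑ s : S, κ r s * y s))) * μ r))
  + ((((1 : ℝ)/2) * ∑ r : S, ∑ s : S, y r * κ r s * (μ s - y s) : ℝ) : EReal)

/-- The functional `G_c(b)`. -/
def Gc {S : Type*} [Fintype S] (κ : S → S → ℝ) (μ c b : S → ℝ) : EReal :=
  (((∑ r : S, b r * Real.log (b r / μ r))
      - (1/2) * ∑ r : S, ∑ s : S, b r * κ r s * b s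
      + (1/2) * ∑ r : S, ∑ s : S, c r * κ r s * μ s : ℝ) : EReal)
  + ∑ r : S, entTerm (c r - b r) ((∑ s : S, κ r s * (c s - b s)) * μ r)

/-- `λ_k(t) = t^{|k|-1} τ(k) e^{-t⟨k,κμ⟩} ∏_r μ_r^{k_r}/k_r!`. -/
def lamT {S : Type*} [Fintype S] (κ : S → S → ℝ) (μ : S → ℝ) (k : S → ℕ) (t : ℝ) : ℝ :=
  t ^ ((∑ s : S, k s) - 1) * tau κ k *
    Real.exp (-t * ∑ r : S, ∑ s : S, (k r : ℝ) * κ r s * μ s) *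
    ∏ r : S, μ r ^ (k r) / (Nat.factorial (k r) : ℝ)


def onG {V : Type*} (E : Finset (Sym2 V)) : SimpleGraph V :=
  SimpleGraph.fromEdgeSet (E : Set (Sym2 V))

lemma onG_adj {V : Type*} (E : Finset (Sym2 V)) (u v : V) :
    (onG E).Adj u v ↔ s(u,v) ∈ E ∧ u ≠ v := by
  simp [onG]

lemma onG_mono {V : Type*} {E F : Finset (Sym2 V)} (h : E ⊆ F) : onG E ≤ onG F :=
  SimpleGraph.fromEdgeSet_mono (by exact_mod_cast h)

def IsTr {V : Type*} (A : Finset V) (E : Finset (Sym2 V)) : Prop :=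
  (∀ e ∈ E, ¬ e.IsDiag ∧ ∀ v ∈ e, v ∈ A) ∧
  (∀ u ∈ A, ∀ v ∈ A, (onG E).Reachable u v) ∧ E.card + 1 = A.card

lemma reach_ind {V : Type*} {G : SimpleGraph V} {P : V → Prop} {u v : V}
    (h : G.Reachable u v) (hu : P u) (hs : ∀ a b, P a → G.Adj a b → P b) : P v := by
  obtain ⟨p⟩ := h
  induction p with
  | nil => exact hu
  | cons hadj p ih => exact ih (hs _ _ hu hadj)

lemma card_bound {V : Type*} [Fintype V] {A : Finset V} {E : Finset (Sym2 V)}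
    (h : ∀ u ∈ A, ∀ v ∈ A, (onG E).Reachable u v) (i : V) (hi : i ∈ A) :
    A.card ≤ E.card + 1 := by
  set E' := E ∪ Aᶜ.image (fun v => s(i,v)) with hE'
  have hreach : ∀ v, (onG E').Reachable i v := by
    intro v
    by_cases hv : v ∈ A
    · exact (h i hi v hv).mono (onG_mono Finset.subset_union_left)
    · apply SimpleGraph.Adj.reachable
      rw [onG_adj]
      refine ⟨?_, fun h => hv (h ▸ hi)⟩
      rw [hE']
      apply Finset.mem_union_right
      exact Finset.mem_image_of_mem _ (by simpa using hv)
  have hc : (onG E').Connected := by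
    have : Nonempty V := ⟨i⟩
    exact ⟨fun u v => (hreach u).symm.trans (hreach v)⟩
  have h1 := hc.card_vert_le_card_edgeSet_add_one
  have h2 : Nat.card (onG E').edgeSet ≤ E'.card := by
    have hcc : Nat.card ((E' : Set (Sym2 V))) = E'.card := by simp
    rw [← hcc]
    apply Nat.card_mono (Finset.finite_toSet E')
    simp [onG]
  have h3 : E'.card ≤ E.card + Aᶜ.card :=
    (Finset.card_union_le _ _).trans (by gcongr; exact Finset.card_image_le)
  have h4 := Finset.card_add_card_compl A
  rw [Nat.card_eq_fintype_card] at h1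
  omega

lemma tree_split {V : Type*} [Fintype V] {E : Finset (Sym2 V)} (hE : IsTr Finset.univ E)
    {i j : V} (hij : s(i,j) ∈ E) (A : Finset V)
    (hA : A = Finset.univ.filter (fun v => (onG (E.erase s(i,j))).Reachable i v)) :
    i ∈ A ∧ j ∉ A ∧ IsTr A ((E.erase s(i,j)).filter (fun e => ∀ v ∈ e, v ∈ A)) ∧
    IsTr Aᶜ ((E.erase s(i,j)).filter (fun e => ∀ v ∈ e, v ∈ Aᶜ)) ∧
    (E.erase s(i,j)).filter (fun e => ∀ v ∈ e, v ∈ A) ∪ 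
    (E.erase s(i,j)).filter (fun e => ∀ v ∈ e, v ∈ Aᶜ) = E.erase s(i,j) := by
  obtain ⟨hd, hr, hc⟩ := hE
  have hF : ∀ v, (onG (E.erase s(i,j))).Reachable i v ∨ (onG (E.erase s(i,j))).Reachable j v := by
    intro v
    apply reach_ind (hr i (by simp) v (by simp))
    · left; rfl
    · intro a b hab hadj
      rw [onG_adj] at hadj
      by_cases hee : s(a,b) = s(i,j)
      · rw [Sym2.eq_iff] at hee
        rcases hee with ⟨rfl, rfl⟩ | ⟨rfl, rfl⟩
        · right; rfl
        · left; rfl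
      · have : (onG (E.erase s(i,j))).Adj a b := by
          rw [onG_adj]; exact ⟨Finset.mem_erase.2 ⟨hee, hadj.1⟩, hadj.2⟩
        exact hab.imp (fun h => h.trans this.reachable) (fun h => h.trans this.reachable)
  have hcF : (E.erase s(i,j)).card + 1 = E.card := Finset.card_erase_add_one hij
  have hdF : ∀ e ∈ E.erase s(i,j), ¬ e.IsDiag := fun e he => (hd e (Finset.mem_of_mem_erase he)).1
  clear hd
  generalize hFF : E.erase s(i,j) = F at *
  have hAm : ∀ v, v ∈ A ↔ (onG F).Reachable i v := by intro v; rw [hA]; simp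
  have hi : i ∈ A := (hAm i).2 (SimpleGraph.Reachable.refl _)
  have hj : j ∉ A := by
    intro hj
    rw [hAm] at hj
    have : ∀ v, (onG F).Reachable i v := fun v => (hF v).elim id (fun h => hj.trans h)
    have := card_bound (A := Finset.univ) (E := F) 
      (fun u _ v _ => (this u).symm.trans (this v)) i (by simp)
    omega
  have hAdj : ∀ a b, (onG F).Adj a b → (a ∈ A ↔ b ∈ A) := by
    intro a b hab
    rw [hAm, hAm]
    exact ⟨fun h => h.trans hab.reachable, fun h => h.trans hab.symm.reachable⟩
  have hU : F.filter (fun e => ∀ v ∈ e, v ∈ A) ∪ F.filter (fun e => ∀ v ∈ e, v ∈ Aᶜ) = F := by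
    ext e
    simp only [Finset.mem_union, Finset.mem_filter]
    refine ⟨by tauto, fun he => ?_⟩
    induction e with | _ a b
    have hne : a ≠ b := by simpa using hdF _ he
    have := hAdj a b ((onG_adj _ _ _).2 ⟨he, hne⟩)
    simp only [Sym2.mem_iff, forall_eq_or_imp, forall_eq, Finset.mem_compl]
    tauto
  have hD : Disjoint (F.filter (fun e => ∀ v ∈ e, v ∈ A)) (F.filter (fun e => ∀ v ∈ e, v ∈ Aᶜ)) := by
    rw [Finset.disjoint_left]
    intro e h1 h2
    simp only [Finset.mem_filter] at h1 h2
    induction e with | _ a b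
    have h3 := h1.2 a (by simp)
    have h4 := h2.2 a (by simp)
    simp at h4; exact h4 h3
  have hr1 : ∀ v ∈ A, (onG (F.filter (fun e => ∀ v ∈ e, v ∈ A))).Reachable i v := by
    intro v hv
    refine (reach_ind (P := fun v => v ∈ A ∧ (onG (F.filter (fun e => ∀ v ∈ e, v ∈ A))).Reachable i v) ((hAm v).1 hv) ⟨hi, SimpleGraph.Reachable.refl _⟩ ?_).2
    rintro a b ⟨ha, hab⟩ hadj
    have hb := (hAdj a b hadj).1 ha
    refine ⟨hb, hab.trans (SimpleGraph.Adj.reachable ?_)⟩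
    rw [onG_adj] at hadj ⊢
    simp [ha, hb, hadj.1, hadj.2]
  have hr2 : ∀ v ∈ Aᶜ, (onG (F.filter (fun e => ∀ v ∈ e, v ∈ Aᶜ))).Reachable j v := by
    intro v hv
    have hjv : (onG F).Reachable j v := by
      rcases hF v with h | h
      · rw [← hAm] at h; simp at hv; exact absurd h hv
      · exact h
    refine (reach_ind (P := fun v => v ∉ A ∧ (onG (F.filter (fun e => ∀ v ∈ e, v ∈ Aᶜ))).Reachable j v) hjv ⟨hj, SimpleGraph.Reachable.refl _⟩ ?_).2
    rintro a b ⟨ha, hab⟩ hadj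
    have hb : b ∉ A := fun h => ha ((hAdj a b hadj).2 h)
    refine ⟨hb, hab.trans (SimpleGraph.Adj.reachable ?_)⟩
    rw [onG_adj] at hadj ⊢
    simp [ha, hb, hadj.1, hadj.2]
  have hR1 : ∀ u ∈ A, ∀ v ∈ A, (onG (F.filter (fun e => ∀ v ∈ e, v ∈ A))).Reachable u v :=
    fun u hu v hv => (hr1 u hu).symm.trans (hr1 v hv)
  have hR2 : ∀ u ∈ Aᶜ, ∀ v ∈ Aᶜ, (onG (F.filter (fun e => ∀ v ∈ e, v ∈ Aᶜ))).Reachable u v :=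
    fun u hu v hv => (hr2 u hu).symm.trans (hr2 v hv)
  have b1 := card_bound hR1 i hi
  have b2 := card_bound hR2 j (by simpa using hj)
  have hcu := Finset.card_union_of_disjoint hD
  rw [hU] at hcu
  have h4 := Finset.card_add_card_compl A
  rw [← Finset.card_univ] at h4
  refine ⟨hi, hj, ⟨?_, hR1, by omega⟩, ⟨?_, hR2, by omega⟩, hU⟩
  · intro e he
    rw [Finset.mem_filter] at he
    exact ⟨hdF e he.1, he.2⟩
  · intro e he
    rw [Finset.mem_filter] at he
    exact ⟨hdF e he.1, he.2⟩

lemma tree_join {V : Type*} [Fintype V] {A : Finset V} {E1 E2 : Finset (Sym2 V)}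
    (h1 : IsTr A E1) (h2 : IsTr Aᶜ E2) {i j : V} (hi : i ∈ A) (hj : j ∈ Aᶜ) :
    s(i,j) ∉ E1 ∪ E2 ∧ Disjoint E1 E2 ∧
    IsTr Finset.univ (insert s(i,j) (E1 ∪ E2)) ∧
    Finset.univ.filter (fun v => (onG (E1 ∪ E2)).Reachable i v) = A ∧
    (E1 ∪ E2).filter (fun e => ∀ v ∈ e, v ∈ A) = E1 ∧
    (E1 ∪ E2).filter (fun e => ∀ v ∈ e, v ∈ Aᶜ) = E2 := by
  obtain ⟨d1, r1, c1⟩ := h1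
  obtain ⟨d2, r2, c2⟩ := h2
  have hx : ∀ e ∈ E1, e ∉ E2 ∧ ¬ ∀ v ∈ e, v ∈ Aᶜ := by
    intro e he
    have := (d1 e he).2
    have h' := fun h => (d2 e h).2
    induction e with | _ a b
    have ha := this a (by simp)
    refine ⟨fun h => ?_, fun h => ?_⟩
    · have := h' h a (by simp)
      simp at this; exact this ha
    · have := h a (by simp)
      simp at this; exact this ha
  have hy : ∀ e ∈ E2, ¬ ∀ v ∈ e, v ∈ A := by
    intro e he h'
    have := (d2 e he).2
    induction e with | _ a b
    have ha := this a (by simp)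
    have := h' a (by simp)
    simp at ha; exact ha this
  have hn : s(i,j) ∉ E1 ∪ E2 := by
    rw [Finset.mem_union]
    rintro (h | h)
    · have := (d1 _ h).2 j (by simp); simp at hj; exact hj this
    · have := (d2 _ h).2 i (by simp); simp at this; exact this hi
  have hdis : Disjoint E1 E2 := Finset.disjoint_left.2 fun e he => (hx e he).1
  have hij : i ≠ j := by rintro rfl; simp at hj; exact hj hi
  refine ⟨hn, hdis, ⟨?_, ?_, ?_⟩, ?_, ?_, ?_⟩
  · intro e he
    refine ⟨?_, by simp⟩
    rw [Finset.mem_insert, Finset.mem_union] at he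
    rcases he with rfl | h | h
    · simpa using hij
    · exact (d1 e h).1
    · exact (d2 e h).1
  · have key : ∀ v, (onG (insert s(i,j) (E1 ∪ E2))).Reachable i v := by
      intro v
      by_cases hv : v ∈ A
      · exact (r1 i hi v hv).mono (onG_mono (by intro x; simp; tauto))
      · have a1 : (onG (insert s(i,j) (E1 ∪ E2))).Adj i j := by rw [onG_adj]; simp [hij]
        exact a1.reachable.trans ((r2 j hj v (by simpa using hv)).mono (onG_mono (by intro x; simp; tauto)))
    exact fun u _ v _ => (key u).symm.trans (key v)
  · rw [Finset.card_insert_of_notMem hn, Finset.card_union_of_disjoint hdis]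
    have h4 := Finset.card_add_card_compl A
    rw [← Finset.card_univ] at h4
    omega
  · ext v
    simp only [Finset.mem_filter, Finset.mem_univ, true_and]
    constructor
    · intro h
      refine reach_ind (P := fun v => v ∈ A) h hi ?_
      intro a b ha hadj
      rw [onG_adj, Finset.mem_union] at hadj
      rcases hadj.1 with h | h
      · exact (d1 _ h).2 b (by simp)
      · have := (d2 _ h).2 a (by simp)
        simp at this; exact absurd ha this
    · intro hv
      exact (r1 i hi v hv).mono (onG_mono Finset.subset_union_left)
  · ext e
    simp only [Finset.mem_filter, Finset.mem_union]
    constructor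
    · rintro ⟨h | h, h'⟩
      · exact h
      · exact absurd h' (hy e h)
    · intro h; exact ⟨Or.inl h, (d1 e h).2⟩
  · ext e
    simp only [Finset.mem_filter, Finset.mem_union]
    constructor
    · rintro ⟨h | h, h'⟩
      · exact absurd h' (hx e h).2
      · exact h
    · intro h; exact ⟨Or.inr h, (d2 e h).2⟩

def trees {V : Type*} [Fintype V] (A : Finset V) : Finset (Finset (Sym2 V)) :=
  Finset.univ.filter (fun E => IsTr A E)

lemma mem_trees {V : Type*} [Fintype V] {A : Finset V} {E : Finset (Sym2 V)} :
    E ∈ trees A ↔ IsTr A E := by simp [trees]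

def TW {V : Type*} [Fintype V] (w : Sym2 V → ℝ) (A : Finset V) : ℝ :=
  ∑ E ∈ trees A, ∏ e ∈ E, w e

lemma card_pairs {V : Type*} [Fintype V] (E : Finset (Sym2 V)) (h : ∀ e ∈ E, ¬ e.IsDiag) :
    (Finset.univ.filter (fun p : V × V => s(p.1,p.2) ∈ E)).card = 2 * E.card := by
  have hm : ∀ p ∈ Finset.univ.filter (fun p : V × V => s(p.1,p.2) ∈ E), s(p.1,p.2) ∈ E := by
    intro p hp; simpa using hp
  rw [Finset.card_eq_sum_card_fiberwise hm, mul_comm, ← smul_eq_mul, ← Finset.sum_const]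
  apply Finset.sum_congr rfl
  intro e he
  have hne := h e he
  induction e with | _ a b
  have hab : a ≠ b := by simpa using hne
  have : ((Finset.univ.filter (fun p : V × V => s(p.1,p.2) ∈ E)).filter (fun p => s(p.1,p.2) = s(a,b)))
      = {(a,b),(b,a)} := by
    ext ⟨u, v⟩
    simp only [Finset.mem_filter, Finset.mem_univ, true_and, Finset.mem_insert, Finset.mem_singleton, Prod.mk.injEq]
    rw [Sym2.eq_iff]
    constructor
    · tauto
    · rintro (⟨rfl, rfl⟩ | ⟨rfl, rfl⟩)
      · exact ⟨he, by tauto⟩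
      · exact ⟨by rwa [Sym2.eq_swap], by tauto⟩
  rw [this, Finset.card_pair]
  simp [hab]

lemma TW_split {V : Type*} [Fintype V] [Nonempty V] (w : Sym2 V → ℝ) :
    2 * ((Fintype.card V : ℝ) - 1) * TW w Finset.univ =
      ∑ A : Finset V, TW w A * TW w Aᶜ * ∑ i ∈ A, ∑ j ∈ Aᶜ, w s(i,j) := by
  have hL : 2 * ((Fintype.card V : ℝ) - 1) * TW w Finset.univ =
      ∑ p ∈ (trees (Finset.univ : Finset V)).sigma
        (fun E => Finset.univ.filter (fun p : V × V => s(p.1,p.2) ∈ E)), ∏ e ∈ p.1, w e := by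
    rw [Finset.sum_sigma, TW, Finset.mul_sum]
    apply Finset.sum_congr rfl
    intro E hE
    rw [mem_trees] at hE
    dsimp only
    rw [Finset.sum_const, card_pairs E (fun e he => (hE.1 e he).1), nsmul_eq_mul]
    have := hE.2.2
    rw [Finset.card_univ] at this
    rw [← this]; push_cast; ring
  have hR : ∑ A : Finset V, TW w A * TW w Aᶜ * ∑ i ∈ A, ∑ j ∈ Aᶜ, w s(i,j) =
      ∑ q ∈ (Finset.univ : Finset (Finset V)).sigma
        (fun A => (trees A ×ˢ trees Aᶜ) ×ˢ (A ×ˢ Aᶜ)),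
        (∏ e ∈ q.2.1.1, w e) * (∏ e ∈ q.2.1.2, w e) * w s(q.2.2.1, q.2.2.2) := by
    rw [Finset.sum_sigma]
    apply Finset.sum_congr rfl
    intro A _
    rw [Finset.sum_product, TW, TW, Finset.sum_mul_sum, ← Finset.sum_product', Finset.sum_mul]
    apply Finset.sum_congr rfl
    intro E _
    rw [← Finset.sum_product', Finset.mul_sum]
  rw [hL, hR]
  refine Finset.sum_bij'
    (fun p _ => ⟨Finset.univ.filter (fun v => (onG (p.1.erase s(p.2.1,p.2.2))).Reachable p.2.1 v),
      (((p.1.erase s(p.2.1,p.2.2)).filter (fun e => ∀ v ∈ e, v ∈ Finset.univ.filter (fun v => (onG (p.1.erase s(p.2.1,p.2.2))).Reachable p.2.1 v)),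
       (p.1.erase s(p.2.1,p.2.2)).filter (fun e => ∀ v ∈ e, v ∈ (Finset.univ.filter (fun v => (onG (p.1.erase s(p.2.1,p.2.2))).Reachable p.2.1 v))ᶜ)), p.2)⟩)
    (fun q _ => ⟨insert s(q.2.2.1, q.2.2.2) (q.2.1.1 ∪ q.2.1.2), q.2.2⟩) ?_ ?_ ?_ ?_ ?_
  · rintro ⟨E, i, j⟩ hp
    simp only [Finset.mem_sigma, mem_trees, Finset.mem_filter, Finset.mem_univ, true_and] at hp
    have := tree_split hp.1 hp.2 _ rfl
    simp only [Finset.mem_sigma, Finset.mem_product, mem_trees]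
    exact ⟨Finset.mem_univ _, ⟨this.2.2.1, this.2.2.2.1⟩, this.1, Finset.mem_compl.2 this.2.1⟩
  · rintro ⟨A, ⟨E1, E2⟩, i, j⟩ hq
    simp only [Finset.mem_sigma, Finset.mem_product, mem_trees] at hq
    have := tree_join hq.2.1.1 hq.2.1.2 hq.2.2.1 hq.2.2.2
    simp only [Finset.mem_sigma, mem_trees, Finset.mem_filter, Finset.mem_univ, true_and]
    exact ⟨this.2.2.1, Finset.mem_insert_self _ _⟩
  · rintro ⟨E, i, j⟩ hp
    simp only [Finset.mem_sigma, mem_trees, Finset.mem_filter, Finset.mem_univ, true_and] at hp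
    have := tree_split hp.1 hp.2 _ rfl
    simp only
    rw [this.2.2.2.2, Finset.insert_erase hp.2]
  · rintro ⟨A, ⟨E1, E2⟩, i, j⟩ hq
    simp only [Finset.mem_sigma, Finset.mem_product, mem_trees] at hq
    obtain ⟨h1, h2, h3, h4, h5, h6⟩ := tree_join hq.2.1.1 hq.2.1.2 hq.2.2.1 hq.2.2.2
    simp only [Finset.erase_insert h1, h4, h5, h6]
  · rintro ⟨E, i, j⟩ hp
    simp only [Finset.mem_sigma, mem_trees, Finset.mem_filter, Finset.mem_univ, true_and] at hp
    have h := tree_split hp.1 hp.2 _ rfl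
    have hj := tree_join h.2.2.1 h.2.2.2.1 h.1 (Finset.mem_compl.2 h.2.1)
    simp only
    rw [← Finset.prod_union hj.2.1, h.2.2.2.2, mul_comm, Finset.mul_prod_erase E w hp.2]

lemma isTr_map {W V : Type*} (f : W ↪ V) (B : Finset W) (E : Finset (Sym2 W)) :
    IsTr (B.map f) (E.map f.sym2Map) ↔ IsTr B E := by
  have hadj : ∀ u v, (onG (E.map f.sym2Map)).Adj (f u) (f v) ↔ (onG E).Adj u v := by
    intro u v
    rw [onG_adj, onG_adj]
    have : s(f u, f v) = f.sym2Map s(u,v) := rfl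
    rw [this, Finset.mem_map']
    simp
  have hreach : ∀ u v, (onG (E.map f.sym2Map)).Reachable (f u) (f v) ↔ (onG E).Reachable u v := by
    intro u v
    constructor
    · intro h
      have : ∃ v', f v' = f v ∧ (onG E).Reachable u v' := by
        refine reach_ind (P := fun z => ∃ v', f v' = z ∧ (onG E).Reachable u v') h
          ⟨u, rfl, SimpleGraph.Reachable.refl _⟩ ?_
        rintro a b ⟨a', rfl, ha⟩ hab
        have hb : ∃ b', f b' = b := by
          have := ((onG_adj _ _ _).1 hab).1
          rw [Finset.mem_map] at this
          obtain ⟨e, he, hee⟩ := this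
          induction e with | _ p q
          have hee' : s(f p, f q) = s(f a', b) := hee
          rw [Sym2.eq_iff] at hee'
          rcases hee' with ⟨_, h⟩ | ⟨h, _⟩
          · exact ⟨q, h⟩
          · exact ⟨p, h⟩
        obtain ⟨b', rfl⟩ := hb
        exact ⟨b', rfl, ha.trans ((hadj _ _).1 hab).reachable⟩
      obtain ⟨v', hv, h⟩ := this
      rwa [← f.injective hv]
    · intro h
      refine reach_ind (P := fun z => (onG (E.map f.sym2Map)).Reachable (f u) (f z)) h
        (SimpleGraph.Reachable.refl _) ?_
      intro a b ha hab
      exact ha.trans ((hadj _ _).2 hab).reachable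
  unfold IsTr
  simp only [Finset.card_map]
  refine and_congr ?_ (and_congr ?_ Iff.rfl)
  · simp only [Finset.forall_mem_map]
    refine forall₂_congr fun e he => ?_
    induction e with | _ p q
    have h1 : f.sym2Map s(p,q) = s(f p, f q) := rfl
    rw [h1]
    simp
  · simp only [Finset.forall_mem_map]
    refine forall₂_congr fun u hu => forall₂_congr fun v hv => hreach u v

lemma TW_map {W V : Type*} [Fintype W] [Fintype V] (f : W ↪ V) (B : Finset W) (w : Sym2 V → ℝ) :
    TW w (B.map f) = TW (fun e => w (e.map f)) B := by
  unfold TW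
  symm
  refine Finset.sum_bij (fun E _ => E.map f.sym2Map) ?_ ?_ ?_ ?_
  · intro E hE
    rw [mem_trees] at hE ⊢
    exact (isTr_map f B E).2 hE
  · intro E _ E' _ h
    exact Finset.map_injective _ h
  · intro E' hE'
    rw [mem_trees] at hE'
    have : ∃ E : Finset (Sym2 W), E.map f.sym2Map = E' := by
      refine ⟨Finset.univ.filter (fun e => f.sym2Map e ∈ E'), ?_⟩
      ext e
      rw [Finset.mem_map]
      constructor
      · rintro ⟨a, ha, rfl⟩
        simpa using ha
      · intro he
        have h2 := (hE'.1 e he).2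
        induction e with | _ p q
        have hp := h2 p (by simp)
        have hq := h2 q (by simp)
        rw [Finset.mem_map] at hp hq
        obtain ⟨p', _, rfl⟩ := hp
        obtain ⟨q', _, rfl⟩ := hq
        exact ⟨s(p',q'), by simpa using he, rfl⟩
    obtain ⟨E, rfl⟩ := this
    exact ⟨E, mem_trees.2 ((isTr_map f B E).1 hE'), rfl⟩
  · intro E _
    rw [Finset.prod_map]
    rfl

lemma treeWeight_eq {S : Type*} (κ : S → S → ℝ) (w : Sym2 S → ℝ) (hw : ∀ r s, w s(r,s) = κ r s)
    (n : ℕ) (x : Fin n → S) :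
    treeWeight n x κ = TW (fun e : Sym2 (Fin n) => w (e.map x)) Finset.univ := by
  have hG : ∀ E : Finset (Fin n × Fin n),
      graphOf E = onG (E.image (fun q => s(q.1,q.2))) := by
    intro E
    ext a b
    rw [onG_adj, graphOf, SimpleGraph.fromRel_adj, and_comm]
    refine and_congr_left fun _ => ?_
    rw [Finset.mem_image]
    constructor
    · rintro (h | h)
      · exact ⟨_, h, rfl⟩
      · exact ⟨_, h, Sym2.eq_swap⟩
    · rintro ⟨⟨p, q⟩, h, hh⟩
      simp only [Sym2.eq_iff] at hh
      rcases hh with ⟨rfl, rfl⟩ | ⟨rfl, rfl⟩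
      · exact Or.inl h
      · exact Or.inr h
  have hinj : Set.InjOn (fun q : Fin n × Fin n => s(q.1,q.2)) (upperPairs n : Set (Fin n × Fin n)) := by
    rintro ⟨a, b⟩ h ⟨c, d⟩ h' hh
    simp only [upperPairs, Finset.coe_filter, Finset.mem_univ, true_and, Set.mem_ofPred_eq] at h h'
    simp only [Sym2.eq_iff] at hh
    rcases hh with ⟨rfl, rfl⟩ | ⟨rfl, rfl⟩
    · rfl
    · exact absurd h (lt_asymm h')
  have hcard : ∀ E ⊆ upperPairs n, (E.image (fun q => s(q.1,q.2))).card = E.card := fun E hE =>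
    Finset.card_image_of_injOn (hinj.mono (by exact_mod_cast hE))
  have hiff : ∀ E ⊆ upperPairs n, ((graphOf E).Connected ∧ E.card + 1 = n ↔
      IsTr Finset.univ (E.image (fun q => s(q.1,q.2)))) := by
    intro E hE
    rw [IsTr, hcard E hE, hG]
    simp only [Finset.card_univ, Fintype.card_fin]
    constructor
    · rintro ⟨h1, h2⟩
      refine ⟨?_, fun u _ v _ => h1.preconnected u v, h2⟩
      intro e he
      refine ⟨?_, by simp⟩
      rw [Finset.mem_image] at he
      obtain ⟨q, hq, rfl⟩ := he
      have := hE hq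
      simp only [upperPairs, Finset.mem_filter, Finset.mem_univ, true_and] at this
      simpa using this.ne
    · rintro ⟨_, h1, h2⟩
      have : Nonempty (Fin n) := ⟨⟨0, by omega⟩⟩
      exact ⟨⟨fun u v => h1 u (by simp) v (by simp)⟩, h2⟩
  unfold treeWeight TW
  refine Finset.sum_bij (fun E _ => E.image (fun q => s(q.1,q.2))) ?_ ?_ ?_ ?_
  · intro E hE
    rw [Finset.mem_filter, Finset.mem_powerset] at hE
    exact mem_trees.2 ((hiff E hE.1).1 hE.2)
  · intro E hE E' hE' h
    rw [Finset.mem_filter, Finset.mem_powerset] at hE hE'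
    have h1 : (fun q : Fin n × Fin n => s(q.1,q.2)) '' (E : Set _) =
        (fun q : Fin n × Fin n => s(q.1,q.2)) '' (E' : Set _) := by
      exact_mod_cast congrArg (fun F : Finset (Sym2 (Fin n)) => (F : Set (Sym2 (Fin n)))) h
    have := (hinj.image_eq_image_iff (by exact_mod_cast hE.1) (by exact_mod_cast hE'.1)).1 h1
    exact_mod_cast this
  · intro E' hE'
    rw [mem_trees] at hE'
    have : ∃ E ⊆ upperPairs n, E.image (fun q => s(q.1,q.2)) = E' := by
      refine ⟨(upperPairs n).filter (fun q => s(q.1,q.2) ∈ E'), Finset.filter_subset _ _, ?_⟩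
      ext e
      simp only [Finset.mem_image, Finset.mem_filter]
      constructor
      · rintro ⟨q, ⟨_, h⟩, rfl⟩; exact h
      · intro he
        have hd := (hE'.1 e he).1
        induction e with | _ a b
        have hab : a ≠ b := by simpa using hd
        rcases lt_or_gt_of_ne hab with h | h
        · exact ⟨(a,b), ⟨by simpa [upperPairs] using h, he⟩, rfl⟩
        · exact ⟨(b,a), ⟨by simpa [upperPairs] using h, by rwa [Sym2.eq_swap]⟩, Sym2.eq_swap⟩
    obtain ⟨E, hE, rfl⟩ := this
    exact ⟨E, by rw [Finset.mem_filter, Finset.mem_powerset]; exact ⟨hE, (hiff E hE).2 hE'⟩, rfl⟩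
  · intro E hE
    rw [Finset.mem_filter, Finset.mem_powerset] at hE
    rw [Finset.prod_image (fun a ha b hb => hinj (hE.1 ha) (hE.1 hb))]
    apply Finset.prod_congr rfl
    intro q _
    simp [hw]

lemma compatVec_card {S : Type*} [Fintype S] (m : S → ℕ) (s : S) :
    Fintype.card {i // compatVec m i = s} = m s := by
  have h1 : (Finset.univ.val.map (compatVec m) : Multiset S) = ∑ s : S, (m s) • ({s} : Multiset S) := by
    rw [Fin.univ_val_map]
    have : List.ofFn (compatVec m) = compatList m := by
      apply List.ext_get
      · simp [compatList_length]
      · intro i h1 h2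
        simp [compatVec]
    rw [this, compatList, Multiset.coe_toList]
  have h2 := congrArg (Multiset.count s) h1
  rw [Multiset.count_map, Multiset.count_sum'] at h2
  simp only [Multiset.count_nsmul, Multiset.count_singleton] at h2
  simp at h2
  rw [Fintype.card_subtype, ← h2, Finset.card_def, Finset.filter_val]
  simp [eq_comm]

lemma tau_eq {S V : Type*} [Fintype S] [Fintype V] (κ : S → S → ℝ) (w : Sym2 S → ℝ)
    (hw : ∀ r s, w s(r,s) = κ r s) (x : V → S) (A : Finset V) (m : S → ℕ)
    (hm : ∀ s, (A.filter (fun v => x v = s)).card = m s) :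
    TW (fun e : Sym2 V => w (e.map x)) A = tau κ m := by
  have hc : ∀ s, Nonempty ({i // compatVec m i = s} ≃ {v : A // x v = s}) := by
    intro s
    rw [← Fintype.card_eq, compatVec_card, ← hm s, ← Fintype.card_coe]
    refine Fintype.card_congr ⟨fun v => ⟨⟨v.1, (Finset.mem_filter.1 v.2).1⟩, (Finset.mem_filter.1 v.2).2⟩,
      fun v => ⟨v.1.1, Finset.mem_filter.2 ⟨v.1.2, v.2⟩⟩, fun v => rfl, fun v => rfl⟩
  let e := fun s => (hc s).some
  let f := Equiv.ofFiberEquiv e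
  have hf : ∀ i, x (f i) = compatVec m i := fun i => Equiv.ofFiberEquiv_map e i
  let g : Fin (∑ s, m s) ↪ V := f.toEmbedding.trans (Function.Embedding.subtype _)
  have hg : Finset.univ.map g = A := by
    ext v
    simp only [Finset.mem_map, Finset.mem_univ, true_and]
    constructor
    · rintro ⟨i, rfl⟩; exact (f i).2
    · intro hv
      exact ⟨f.symm ⟨v, hv⟩, by simp [g]⟩
  rw [tau, treeWeight_eq κ w hw, ← hg, TW_map]
  congr 1
  funext e
  rw [Sym2.map_map]
  congr 2
  funext i
  exact hf i

def cnt {S : Type*} {k : S → ℕ} (A : Finset (Σ s, Fin (k s))) (s : S) : ℕ :=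
  (A.filter (fun v => v.1 = s)).card

lemma cnt_univ {S : Type*} [Fintype S] (k : S → ℕ) (s : S) :
    cnt (Finset.univ : Finset (Σ s, Fin (k s))) s = k s := by
  have : (Finset.univ : Finset (Σ s, Fin (k s))).filter (fun v => v.1 = s) =
      (Finset.univ : Finset (Fin (k s))).map (Function.Embedding.sigmaMk s) := by
    ext ⟨r, i⟩
    simp only [Finset.mem_filter, Finset.mem_univ, true_and, Finset.mem_map]
    constructor
    · rintro rfl; exact ⟨i, rfl⟩
    · rintro ⟨j, hj⟩
      exact (congrArg Sigma.fst hj).symm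
  rw [cnt, this]; simp

lemma TW_split_dec {V : Type*} [Fintype V] [inst : DecidableEq V] [Nonempty V] (w : Sym2 V → ℝ) :
    2 * ((Fintype.card V : ℝ) - 1) * TW w Finset.univ =
      ∑ A : Finset V, TW w A * TW w Aᶜ * ∑ i ∈ A, ∑ j ∈ Aᶜ, w s(i,j) := by
  have h : inst = fun a b => Classical.propDecidable (a = b) := Subsingleton.elim _ _
  subst h
  exact TW_split w

lemma cnt_add {S : Type*} [Fintype S] (k : S → ℕ) [DecidableEq (Σ s, Fin (k s))] (A : Finset (Σ s, Fin (k s))) (s : S) :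
    cnt A s + cnt Aᶜ s = k s := by
  rw [← cnt_univ k s, cnt, cnt, cnt, ← Finset.card_union_of_disjoint, ← Finset.filter_union,
    Finset.union_compl]
  exact Finset.disjoint_filter_filter disjoint_compl_right

lemma card_cnt {S : Type*} [Fintype S] (k m : S → ℕ) :
    ((Finset.univ : Finset (Finset (Σ s, Fin (k s)))).filter (fun A => cnt A = m)).card
      = ∏ s, (k s).choose (m s) := by
  have : ∏ s, (k s).choose (m s) =
      (Fintype.piFinset (fun s => Finset.powersetCard (m s) (Finset.univ : Finset (Fin (k s))))).card := by
    simp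
  rw [this]
  have hc : ∀ (A : Finset (Σ s, Fin (k s))) (s : S),
      cnt A s = (Finset.univ.filter (fun i => (⟨s, i⟩ : Σ s, Fin (k s)) ∈ A)).card := by
    intro A s
    rw [cnt, ← Finset.card_map (Function.Embedding.sigmaMk (β := fun s => Fin (k s)) s)]
    congr 1
    ext ⟨r, i⟩
    simp only [Finset.mem_filter, Finset.mem_univ, true_and, Finset.mem_map]
    constructor
    · rintro ⟨h, rfl⟩; exact ⟨i, h, rfl⟩
    · rintro ⟨j, h, hj⟩
      have h1 : s = r := congrArg Sigma.fst hj
      exact ⟨by rw [← hj]; exact h, h1.symm⟩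
  refine Finset.card_bij' (fun A _ s => Finset.univ.filter (fun i => (⟨s, i⟩ : Σ s, Fin (k s)) ∈ A))
    (fun B _ => Finset.univ.filter (fun v => v.2 ∈ B v.1)) ?_ ?_ ?_ ?_
  · intro A hA
    simp only [Finset.mem_filter, Finset.mem_univ, true_and] at hA
    rw [Fintype.mem_piFinset]
    intro s
    rw [Finset.mem_powersetCard]
    exact ⟨Finset.subset_univ _, by rw [← hc, hA]⟩
  · intro B hB
    rw [Fintype.mem_piFinset] at hB
    simp only [Finset.mem_filter, Finset.mem_univ, true_and]
    funext s
    rw [hc, ← (Finset.mem_powersetCard.1 (hB s)).2]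
    congr 1
    ext i
    simp
  · intro A hA
    ext v
    simp
  · intro B hB
    funext s
    ext i
    simp

lemma sum_cnt {S : Type*} [Fintype S] {k : S → ℕ} (A : Finset (Σ s, Fin (k s))) (g : S → ℝ) :
    ∑ i ∈ A, g i.1 = ∑ s, (cnt A s : ℝ) * g s := by
  rw [← Finset.sum_fiberwise A (fun v => v.1)]
  apply Finset.sum_congr rfl
  intro s _
  rw [cnt, ← nsmul_eq_mul, ← Finset.sum_const]
  apply Finset.sum_congr rfl
  intro v hv
  rw [(Finset.mem_filter.1 hv).2]

lemma tau_rec {S : Type*} [Fintype S] [DecidableEq S] (κ : S → S → ℝ)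
    (hκsym : ∀ r s, κ r s = κ s r) (k : S → ℕ) (hk : k ≠ 0) :
    2 * (((∑ s, k s : ℕ) : ℝ) - 1) * tau κ k =
      ∑ m ∈ (Finset.Icc 0 k).filter (fun m => m ≠ 0 ∧ m ≠ k),
        (∏ s, ((k s).choose (m s) : ℝ)) * (tau κ m * tau κ (k - m) *
            ∑ r : S, ∑ s : S, (m r : ℝ) * κ r s * ((k - m) s : ℝ)) := by
  let w : Sym2 S → ℝ := Sym2.lift ⟨κ, hκsym⟩
  have hw : ∀ r s, w s(r,s) = κ r s := fun r s => rfl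
  have hne : Nonempty (Σ s, Fin (k s)) := by
    obtain ⟨s, hs⟩ := Function.ne_iff.1 hk
    exact ⟨⟨s, ⟨0, Nat.pos_of_ne_zero hs⟩⟩⟩
  have h := TW_split_dec (V := Σ s, Fin (k s)) (fun e => w (e.map Sigma.fst))
  rw [tau_eq κ w hw Sigma.fst Finset.univ k (cnt_univ k)] at h
  have hcard : Fintype.card (Σ s, Fin (k s)) = ∑ s, k s := by simp
  rw [hcard] at h
  rw [h]
  set G : (S → ℕ) → ℝ := fun m => tau κ m * tau κ (k - m) *
            ∑ r : S, ∑ s : S, (m r : ℝ) * κ r s * ((k - m) s : ℝ) with hG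
  have hle : ∀ A : Finset (Σ s, Fin (k s)), cnt A ∈ Finset.Icc 0 k := by
    intro A
    rw [Finset.mem_Icc]
    exact ⟨fun s => Nat.zero_le _, fun s => by have := cnt_add k A s; show cnt A s ≤ k s; omega⟩
  have hterm : ∀ A : Finset (Σ s, Fin (k s)),
      TW (fun e => w (e.map Sigma.fst)) A * TW (fun e => w (e.map Sigma.fst)) Aᶜ *
        ∑ i ∈ A, ∑ j ∈ Aᶜ, w (s(i,j).map Sigma.fst) = G (cnt A) := by
    intro A
    have hco : cnt Aᶜ = k - cnt A := by
      funext s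
      have := cnt_add k A s
      simp only [Pi.sub_apply]; omega
    rw [tau_eq κ w hw Sigma.fst A (cnt A) (fun s => rfl),
      tau_eq κ w hw Sigma.fst Aᶜ (k - cnt A) (fun s => by rw [← hco]; rfl), hG]
    simp only
    congr 1
    simp only [Sym2.map_mk, hw]
    rw [sum_cnt A (fun r => ∑ j ∈ Aᶜ, κ r j.1)]
    apply Finset.sum_congr rfl
    intro r _
    rw [sum_cnt Aᶜ (fun s => κ r s), hco, Finset.mul_sum]
    apply Finset.sum_congr rfl
    intro s _
    ring
  rw [Finset.sum_congr rfl (fun A _ => hterm A),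
    ← Finset.sum_fiberwise_of_maps_to (g := cnt) (t := Finset.Icc 0 k) (fun A _ => hle A)]
  have hfib : ∀ m ∈ Finset.Icc 0 k,
      ∑ A ∈ (Finset.univ : Finset (Finset (Σ s, Fin (k s)))).filter (fun A => cnt A = m), G (cnt A)
      = (∏ s, ((k s).choose (m s) : ℝ)) * G m := by
    intro m _
    rw [← Nat.cast_prod, ← card_cnt, ← nsmul_eq_mul, ← Finset.sum_const]
    apply Finset.sum_congr rfl
    intro A hA
    rw [(Finset.mem_filter.1 hA).2]
  have e1 := Finset.sum_congr (rfl : Finset.Icc 0 k = _) hfib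
  refine Eq.trans ?_ (e1.trans ?_)
  · apply Finset.sum_congr rfl
    intro m _
    congr 1
  · symm
    apply Finset.sum_subset (Finset.filter_subset _ _)
    intro m hm hm'
    have : m = 0 ∨ m = k := by
      by_contra hcon
      push Not at hcon
      exact hm' (Finset.mem_filter.2 ⟨hm, hcon⟩)
    rcases this with rfl | rfl
    · simp [hG]
    · simp [hG]

/-- the explicit minimizer solves the multi-type Flory equation. -/
theorem lamT_solves_flory
    {S : Type*} [Fintype S] [DecidableEq S] [Nonempty S]
    (κ : S → S → ℝ) (hκsym : ∀ r s, κ r s = κ s r) (hκ0 : ∀ r s, 0 ≤ κ r s)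
    (μ : S → ℝ) (hμ0 : ∀ r, 0 < μ r) (hμ1 : (∑ r : S, μ r) = 1)
    (hirr : Irred κ μ)
    (k : S → ℕ) (hk : k ≠ 0) (t : ℝ) (ht : 0 < t) :
    HasDerivAt (lamT κ μ k)
      ((1/2) * (∑ m ∈ (Finset.Icc 0 k).filter (fun m => m ≠ 0 ∧ m ≠ k),
          lamT κ μ m t * lamT κ μ (k - m) t *
            ∑ r : S, ∑ s : S, (m r : ℝ) * κ r s * ((k - m) s : ℝ))
        - lamT κ μ k t * ∑ r : S, ∑ s : S, (k r : ℝ) * κ r s * μ s) t := by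
  set L : (S → ℕ) → ℝ := fun k => ∑ r : S, ∑ s : S, (k r : ℝ) * κ r s * μ s with hL
  set P : (S → ℕ) → ℝ := fun k => ∏ r : S, μ r ^ (k r) / (Nat.factorial (k r) : ℝ) with hP
  set n := ∑ s, k s with hn
  have hn1 : 1 ≤ n := by
    obtain ⟨s, hs⟩ := Function.ne_iff.1 hk
    have : k s ≤ n := Finset.single_le_sum (f := k) (fun _ _ => Nat.zero_le _) (Finset.mem_univ s)
    have : k s ≠ 0 := hs
    omega
  have hlam : ∀ (m : S → ℕ) (t : ℝ), lamT κ μ m t =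
      t ^ ((∑ s, m s) - 1) * tau κ m * Real.exp (-t * L m) * P m := fun m t => rfl
  have hterm : ∀ m ∈ (Finset.Icc 0 k).filter (fun m => m ≠ 0 ∧ m ≠ k),
      lamT κ μ m t * lamT κ μ (k - m) t *
            ∑ r : S, ∑ s : S, (m r : ℝ) * κ r s * ((k - m) s : ℝ) =
      (t ^ (n - 2) * Real.exp (-t * L k) * P k) * ((∏ s, ((k s).choose (m s) : ℝ)) * (tau κ m * tau κ (k - m) *
            ∑ r : S, ∑ s : S, (m r : ℝ) * κ r s * ((k - m) s : ℝ))) := by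
    intro m hm
    rw [Finset.mem_filter, Finset.mem_Icc] at hm
    obtain ⟨⟨_, hmk⟩, hm0, hmk'⟩ := hm
    have hsum : ∑ s, m s + ∑ s, (k - m) s = n := by
      rw [← Finset.sum_add_distrib, hn]
      apply Finset.sum_congr rfl
      intro s _
      have : m s ≤ k s := hmk s
      simp only [Pi.sub_apply]; omega
    have ha : 1 ≤ ∑ s, m s := by
      obtain ⟨s, hs⟩ := Function.ne_iff.1 hm0
      have : m s ≤ ∑ s, m s := Finset.single_le_sum (f := m) (fun _ _ => Nat.zero_le _) (Finset.mem_univ s)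
      have : m s ≠ 0 := hs
      omega
    have hb : 1 ≤ ∑ s, (k - m) s := by
      obtain ⟨s, hs⟩ := Function.ne_iff.1 hmk'
      have h1 : (k - m) s ≤ ∑ s, (k - m) s :=
        Finset.single_le_sum (f := (k - m)) (fun _ _ => Nat.zero_le _) (Finset.mem_univ s)
      have : m s ≤ k s := hmk s
      simp only [Pi.sub_apply] at h1 hs ⊢
      omega
    have hLa : L k = L m + L (k - m) := by
      simp only [hL]
      rw [← Finset.sum_add_distrib]
      apply Finset.sum_congr rfl
      intro r _
      rw [← Finset.sum_add_distrib]
      apply Finset.sum_congr rfl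
      intro s _
      rw [Pi.sub_apply, Nat.cast_sub (hmk r)]
      ring
    have hPa : P m * P (k - m) = P k * ∏ s, ((k s).choose (m s) : ℝ) := by
      simp only [hP]
      rw [← Finset.prod_mul_distrib, ← Finset.prod_mul_distrib]
      apply Finset.prod_congr rfl
      intro s _
      have h1 := Nat.choose_mul_factorial_mul_factorial (hmk s)
      have h2 : ((k s).choose (m s) : ℝ) * (m s).factorial * (k s - m s).factorial = (k s).factorial := by
        exact_mod_cast h1
      have h3 : μ s ^ k s = μ s ^ m s * μ s ^ (k s - m s) := by
        rw [← pow_add]; congr 1; have : m s ≤ k s := hmk s; omega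
      have f1 : ((m s).factorial : ℝ) ≠ 0 := by positivity
      have f2 : ((k s - m s).factorial : ℝ) ≠ 0 := by positivity
      have f3 : ((k s).factorial : ℝ) ≠ 0 := by positivity
      rw [Pi.sub_apply, h3]
      field_simp
      rw [← h2]
      ring
    have hta : t ^ (n - 2) = t ^ ((∑ s, m s) - 1) * t ^ ((∑ s, (k - m) s) - 1) := by
      rw [← pow_add]; congr 1; omega
    have hea : Real.exp (-t * L k) = Real.exp (-t * L m) * Real.exp (-t * L (k - m)) := by
      rw [← Real.exp_add, hLa]; congr 1; ring
    rw [hlam, hlam, hta, hea]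
    linear_combination (t ^ ((∑ s, m s) - 1) * t ^ ((∑ s, (k - m) s) - 1) * Real.exp (-t * L m) * Real.exp (-t * L (k - m)) * tau κ m * tau κ (k - m) * ∑ r : S, ∑ s : S, (m r : ℝ) * κ r s * ((k - m) s : ℝ)) * hPa
  rw [Finset.sum_congr rfl hterm, ← Finset.mul_sum, ← tau_rec κ hκsym k hk]
  have hd : HasDerivAt (fun t : ℝ => t ^ (n - 1) * tau κ k * Real.exp (-t * L k) * P k)
      (((((n - 1 : ℕ) : ℝ) * t ^ (n - 1 - 1) * tau κ k) * Real.exp (-t * L k) +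
        t ^ (n - 1) * tau κ k * (Real.exp (-t * L k) * (-1 * L k))) * P k) t :=
    ((((hasDerivAt_pow (n-1) t).mul_const _).mul
      (((hasDerivAt_id t).neg.mul_const (L k)).exp)).mul_const _)
  have hf : lamT κ μ k = fun t : ℝ => t ^ (n - 1) * tau κ k * Real.exp (-t * L k) * P k := by
    funext t; rw [hlam]
  rw [hlam, hf]
  convert hd using 1
  rw [Nat.cast_sub hn1, Nat.sub_sub]
  rw [← hn, show (∑ r : S, ∑ s : S, (k r : ℝ) * κ r s * μ s) = L k from rfl, Nat.cast_one]
  ring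

end
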